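/- Let (M,g,Ω) be a quasi-Einstein manifold of dimension d ≥ 3, meaning Hess_g Ω + Ω · Sch_g − 𝔰 g = 0 with 𝔰 := d^{-1}(□_g Ω + Ω L), where L is the trace of the Schouten tensor. Then the quantity λ := 2𝔰Ω − |∇Ω|²_g is constant on M. -/

import Mathlib

noncomputable section
open scoped BigOperators

/-- Partial derivative of `f` in the `i`-th coordinate direction at `x`. -/
def pd {d : ℕ} (i : Fin d) (f : (Fin d → ℝ) → ℝ) (x : Fin d → ℝ) : ℝ :=
  fderiv ℝ f x (Pi.single i 1)

/-- The inverse metric `g^{ij}` at `x`. -/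
def minv {d : ℕ} (g : (Fin d → ℝ) → Fin d → Fin d → ℝ) (x : Fin d → ℝ) :
    Matrix (Fin d) (Fin d) ℝ :=
  (Matrix.of (g x))⁻¹

/-- Christoffel symbols `Γ^k_{ij}` of the Levi-Civita connection of `g` in coordinates. -/
def christoffel {d : ℕ} (g : (Fin d → ℝ) → Fin d → Fin d → ℝ) (x : Fin d → ℝ)
    (k i j : Fin d) : ℝ :=
  (1 / 2) * ∑ l, minv g x k l *
    (pd i (fun y => g y l j) x + pd j (fun y => g y l i) x - pd l (fun y => g y i j) x)

/-- Hessian `(∇²f)_{ij}` with respect to the Levi-Civita connection of `g`. -/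
def hessT {d : ℕ} (g : (Fin d → ℝ) → Fin d → Fin d → ℝ) (f : (Fin d → ℝ) → ℝ)
    (x : Fin d → ℝ) (i j : Fin d) : ℝ :=
  pd i (pd j f) x - ∑ k, christoffel g x k i j * pd k f x

/-- Ricci tensor `R_{ij}` of `g` in coordinates. -/
def ricciT {d : ℕ} (g : (Fin d → ℝ) → Fin d → Fin d → ℝ) (x : Fin d → ℝ)
    (i j : Fin d) : ℝ :=
  (∑ k, (pd k (fun y => christoffel g y k i j) x - pd i (fun y => christoffel g y k k j) x))
    + ∑ k, ∑ l, (christoffel g x k k l * christoffel g x l i j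
        - christoffel g x k i l * christoffel g x l k j)

/-- Scalar curvature `Scal_g = g^{ij} R_{ij}`. -/
def scalT {d : ℕ} (g : (Fin d → ℝ) → Fin d → Fin d → ℝ) (x : Fin d → ℝ) : ℝ :=
  ∑ i, ∑ j, minv g x i j * ricciT g x i j

/-- Schouten tensor `Sch_g = (1/(d-2))(Ric_g - Scal_g/(2(d-1)) g)`. -/
def schoutenT {d : ℕ} (g : (Fin d → ℝ) → Fin d → Fin d → ℝ) (x : Fin d → ℝ)
    (i j : Fin d) : ℝ :=
  (1 / ((d : ℝ) - 2)) * (ricciT g x i j - scalT g x / (2 * ((d : ℝ) - 1)) * g x i j)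

/-- Trace (with respect to `g`) of the Schouten tensor. -/
def ltrT {d : ℕ} (g : (Fin d → ℝ) → Fin d → Fin d → ℝ) (x : Fin d → ℝ) : ℝ :=
  ∑ i, ∑ j, minv g x i j * schoutenT g x i j

/-- Laplace–Beltrami operator `□_g f = g^{ij}(∇²f)_{ij}`. -/
def boxT {d : ℕ} (g : (Fin d → ℝ) → Fin d → Fin d → ℝ) (f : (Fin d → ℝ) → ℝ)
    (x : Fin d → ℝ) : ℝ :=
  ∑ i, ∑ j, minv g x i j * hessT g f x i j

/-- Trace-free part (with respect to `g`) of a symmetric (0,2)-tensor `T`: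
`T - (tr_g T / d) g`. -/
def tfT {d : ℕ} (g T : (Fin d → ℝ) → Fin d → Fin d → ℝ) (x : Fin d → ℝ)
    (i j : Fin d) : ℝ :=
  T x i j - ((∑ a, ∑ b, minv g x a b * T x a b) / (d : ℝ)) * g x i j

/-- Gradient `(grad f)^i = g^{ij} ∂_j f`. -/
def gradT {d : ℕ} (g : (Fin d → ℝ) → Fin d → Fin d → ℝ) (f : (Fin d → ℝ) → ℝ)
    (x : Fin d → ℝ) (i : Fin d) : ℝ :=
  ∑ j, minv g x i j * pd j f x

/-- `|∇f|²_g = g^{ij} ∂_i f ∂_j f`. -/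
def normSqGradT {d : ℕ} (g : (Fin d → ℝ) → Fin d → Fin d → ℝ) (f : (Fin d → ℝ) → ℝ)
    (x : Fin d → ℝ) : ℝ :=
  ∑ i, gradT g f x i * pd i f x

/-- Lie derivative of the metric along the vector field `η`:
`(L_η g)_{ij} = η^k ∂_k g_{ij} + g_{kj} ∂_i η^k + g_{ik} ∂_j η^k`. -/
def lieMetric {d : ℕ} (g : (Fin d → ℝ) → Fin d → Fin d → ℝ)
    (η : (Fin d → ℝ) → Fin d → ℝ) (x : Fin d → ℝ) (i j : Fin d) : ℝ :=
  ∑ k, (η x k * pd k (fun y => g y i j) x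
    + g x k j * pd i (fun y => η y k) x + g x i k * pd j (fun y => η y k) x)

/-- Lie derivative of the inverse metric along `η`:
`(L_η g⁻¹)^{ij} = η^k ∂_k g^{ij} - g^{kj} ∂_k η^i - g^{ik} ∂_k η^j`. -/
def lieInvMetric {d : ℕ} (g : (Fin d → ℝ) → Fin d → Fin d → ℝ)
    (η : (Fin d → ℝ) → Fin d → ℝ) (x : Fin d → ℝ) (i j : Fin d) : ℝ :=
  ∑ k, (η x k * pd k (fun y => minv g y i j) x
    - minv g x k j * pd k (fun y => η y i) x - minv g x i k * pd k (fun y => η y j) x)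

/-- The quasi-Einstein scalar `𝔰 = d⁻¹(□_g Ω + Ω L)`, `L` the trace of the Schouten tensor. -/
def sQE {d : ℕ} (g : (Fin d → ℝ) → Fin d → Fin d → ℝ) (Ω : (Fin d → ℝ) → ℝ)
    (x : Fin d → ℝ) : ℝ :=
  (1 / (d : ℝ)) * (boxT g Ω x + Ω x * ltrT g x)


/-! Helper lemmas -/

/-- smoothness -/
def Sm {d : ℕ} (f : (Fin d → ℝ) → ℝ) : Prop := ContDiff ℝ (⊤ : ℕ∞) f

theorem Sm.diff {d : ℕ} {f : (Fin d → ℝ) → ℝ} (h : Sm f) : Differentiable ℝ f :=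
  ContDiff.differentiable h (by simp)

theorem Sm.pd {d : ℕ} {f : (Fin d → ℝ) → ℝ} (h : Sm f) (i : Fin d) : Sm (pd i f) := by
  have h1 : ContDiff ℝ (⊤ : ℕ∞) (fderiv ℝ f) := ContDiff.fderiv_right h (by simp)
  exact h1.clm_apply contDiff_const

theorem Sm.add {d : ℕ} {f f' : (Fin d → ℝ) → ℝ} (h : Sm f) (h' : Sm f') :
    Sm (fun y => f y + f' y) := ContDiff.add h h'
theorem Sm.sub {d : ℕ} {f f' : (Fin d → ℝ) → ℝ} (h : Sm f) (h' : Sm f') :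
    Sm (fun y => f y - f' y) := ContDiff.sub h h'
theorem Sm.neg {d : ℕ} {f : (Fin d → ℝ) → ℝ} (h : Sm f) :
    Sm (fun y => - f y) := ContDiff.neg h
theorem Sm.mul {d : ℕ} {f f' : (Fin d → ℝ) → ℝ} (h : Sm f) (h' : Sm f') :
    Sm (fun y => f y * f' y) := ContDiff.mul h h'
theorem Sm.const {d : ℕ} (c : ℝ) : Sm (fun _ : Fin d → ℝ => c) := contDiff_const
theorem Sm.sum {d : ℕ} {ι : Type*} {s : Finset ι} {f : ι → (Fin d → ℝ) → ℝ} (h : ∀ i, Sm (f i)) :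
    Sm (fun y => ∑ i ∈ s, f i y) := ContDiff.sum (fun i _ => h i)
theorem Sm.prod {d : ℕ} {ι : Type*} {s : Finset ι} {f : ι → (Fin d → ℝ) → ℝ} (h : ∀ i, Sm (f i)) :
    Sm (fun y => ∏ i ∈ s, f i y) := contDiff_prod (fun i _ => h i)

theorem pd_add' {d : ℕ} {f f' : (Fin d → ℝ) → ℝ} (h : Sm f) (h' : Sm f') (i : Fin d)
    (x : Fin d → ℝ) : pd i (fun y => f y + f' y) x = pd i f x + pd i f' x := by
  unfold pd
  rw [fderiv_fun_add (h.diff x) (h'.diff x)]; rfl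
theorem pd_sub' {d : ℕ} {f f' : (Fin d → ℝ) → ℝ} (h : Sm f) (h' : Sm f') (i : Fin d)
    (x : Fin d → ℝ) : pd i (fun y => f y - f' y) x = pd i f x - pd i f' x := by
  unfold pd
  rw [fderiv_fun_sub (h.diff x) (h'.diff x)]; rfl
theorem pd_neg' {d : ℕ} {f : (Fin d → ℝ) → ℝ} (i : Fin d)
    (x : Fin d → ℝ) : pd i (fun y => - f y) x = - pd i f x := by
  unfold pd
  rw [fderiv_fun_neg]; rfl
theorem pd_mul' {d : ℕ} {f f' : (Fin d → ℝ) → ℝ} (h : Sm f) (h' : Sm f') (i : Fin d)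
    (x : Fin d → ℝ) : pd i (fun y => f y * f' y) x = pd i f x * f' x + f x * pd i f' x := by
  unfold pd
  rw [fderiv_fun_mul (h.diff x) (h'.diff x)]; simp; ring
theorem pd_const' {d : ℕ} (c : ℝ) (i : Fin d)
    (x : Fin d → ℝ) : pd i (fun _ => c) x = 0 := by
  unfold pd
  simp
theorem pd_sum' {d : ℕ} {ι : Type*} {s : Finset ι} {f : ι → (Fin d → ℝ) → ℝ}
    (h : ∀ i, Sm (f i)) (i : Fin d) (x : Fin d → ℝ) :
    pd i (fun y => ∑ k ∈ s, f k y) x = ∑ k ∈ s, pd i (f k) x := by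
  unfold pd
  rw [fderiv_fun_sum (fun k _ => (h k).diff x)]
  simp
theorem pd_comm' {d : ℕ} {f : (Fin d → ℝ) → ℝ} (h : Sm f) (i j : Fin d)
    (x : Fin d → ℝ) : pd i (pd j f) x = pd j (pd i f) x := by
  have h1 : Differentiable ℝ (fderiv ℝ f) :=
    (ContDiff.fderiv_right (m := (⊤ : ℕ∞)) h (by simp)).differentiable (by simp)
  have key : ∀ a b : Fin d, pd a (pd b f) x
      = fderiv ℝ (fderiv ℝ f) x (Pi.single a 1) (Pi.single b 1) := by
    intro a b
    unfold pd
    rw [fderiv_clm_apply (h1 x) (by fun_prop)]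
    simp
  rw [key, key]
  have hs : IsSymmSndFDerivAt ℝ f x :=
    (ContDiff.contDiffAt h).isSymmSndFDerivAt (by simp only [minSmoothness_of_isRCLikeNormedField]; exact WithTop.coe_le_coe.2 le_top)
  exact hs.eq _ _

/-- entrywise smoothness -/
def SmM {d : ℕ} (F : (Fin d → ℝ) → Matrix (Fin d) (Fin d) ℝ) : Prop :=
  ∀ a b, Sm (fun y => F y a b)

/-- entrywise partial derivative -/
def dM {d : ℕ} (i : Fin d) (F : (Fin d → ℝ) → Matrix (Fin d) (Fin d) ℝ) (x : Fin d → ℝ) :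
    Matrix (Fin d) (Fin d) ℝ := Matrix.of fun a b => pd i (fun y => F y a b) x

section mat
variable {d : ℕ} {F G : (Fin d → ℝ) → Matrix (Fin d) (Fin d) ℝ}

theorem SmM.dM (hF : SmM F) (i : Fin d) : SmM (dM i F) := fun a b => (hF a b).pd i
theorem SmM.add (hF : SmM F) (hG : SmM G) : SmM (fun y => F y + G y) :=
  fun a b => (hF a b).add (hG a b)
theorem SmM.sub (hF : SmM F) (hG : SmM G) : SmM (fun y => F y - G y) :=
  fun a b => (hF a b).sub (hG a b)
theorem SmM.neg (hF : SmM F) : SmM (fun y => - F y) :=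
  fun a b => (hF a b).neg
theorem SmM.transpose (hF : SmM F) : SmM (fun y => (F y).transpose) :=
  fun a b => hF b a
theorem SmM.mul (hF : SmM F) (hG : SmM G) : SmM (fun y => F y * G y) := by
  intro a b
  simp only [Matrix.mul_apply]
  exact Sm.sum fun k => (hF a k).mul (hG k b)

theorem dM_add (hF : SmM F) (hG : SmM G) (i : Fin d) (x : Fin d → ℝ) :
    dM i (fun y => F y + G y) x = dM i F x + dM i G x := by
  ext a b; exact pd_add' (hF a b) (hG a b) i x
theorem dM_sub (hF : SmM F) (hG : SmM G) (i : Fin d) (x : Fin d → ℝ) :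
    dM i (fun y => F y - G y) x = dM i F x - dM i G x := by
  ext a b; exact pd_sub' (hF a b) (hG a b) i x
theorem dM_neg (i : Fin d) (x : Fin d → ℝ) :
    dM i (fun y => - F y) x = - dM i F x := by
  ext a b; exact pd_neg' i x
theorem dM_transpose (i : Fin d) (x : Fin d → ℝ) :
    dM i (fun y => (F y).transpose) x = (dM i F x).transpose := rfl
theorem dM_mul (hF : SmM F) (hG : SmM G) (i : Fin d) (x : Fin d → ℝ) :
    dM i (fun y => F y * G y) x = dM i F x * G x + F x * dM i G x := by
  ext a b
  simp only [Matrix.mul_apply, dM, Matrix.of_apply, Matrix.add_apply]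
  rw [pd_sum' fun k => (hF a k).mul (hG k b), ← Finset.sum_add_distrib]
  exact Finset.sum_congr rfl fun k _ => pd_mul' (hF a k) (hG k b) i x
theorem dM_comm (hF : SmM F) (i j : Fin d) (x : Fin d → ℝ) :
    dM i (dM j F) x = dM j (dM i F) x := by
  ext a b; exact pd_comm' (hF a b) i j x
end mat

/-- curvature matrices -/
def Rm {d : ℕ} (Γ : Fin d → (Fin d → ℝ) → Matrix (Fin d) (Fin d) ℝ) (i j : Fin d)
    (y : Fin d → ℝ) : Matrix (Fin d) (Fin d) ℝ :=
  dM i (Γ j) y - dM j (Γ i) y + Γ i y * Γ j y - Γ j y * Γ i y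

section curv
variable {d : ℕ} {Γ : Fin d → (Fin d → ℝ) → Matrix (Fin d) (Fin d) ℝ}
  {H : (Fin d → ℝ) → Matrix (Fin d) (Fin d) ℝ}

theorem Rm_smooth (hΓ : ∀ i, SmM (Γ i)) (i j : Fin d) : SmM (Rm Γ i j) :=
  ((((hΓ j).dM i).sub ((hΓ i).dM j)).add ((hΓ i).mul (hΓ j))).sub ((hΓ j).mul (hΓ i))

theorem dM_Rm (hΓ : ∀ i, SmM (Γ i)) (m i j : Fin d) (x : Fin d → ℝ) :
    dM m (Rm Γ i j) x = dM m (dM i (Γ j)) x - dM m (dM j (Γ i)) x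
      + (dM m (Γ i) x * Γ j x + Γ i x * dM m (Γ j) x)
      - (dM m (Γ j) x * Γ i x + Γ j x * dM m (Γ i) x) := by
  have h1 := ((hΓ j).dM i)
  have h2 := ((hΓ i).dM j)
  have h3 := ((hΓ i).mul (hΓ j))
  have h4 := ((hΓ j).mul (hΓ i))
  rw [← dM_mul (hΓ i) (hΓ j), ← dM_mul (hΓ j) (hΓ i), ← dM_sub h1 h2,
    ← dM_add (h1.sub h2) h3, ← dM_sub ((h1.sub h2).add h3) h4]
  rfl

theorem Rm_bianchi (hΓ : ∀ i, SmM (Γ i)) (m i j : Fin d) (x : Fin d → ℝ) :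
    (dM m (Rm Γ i j) x + Γ m x * Rm Γ i j x - Rm Γ i j x * Γ m x)
    + (dM i (Rm Γ j m) x + Γ i x * Rm Γ j m x - Rm Γ j m x * Γ i x)
    + (dM j (Rm Γ m i) x + Γ j x * Rm Γ m i x - Rm Γ m i x * Γ j x) = 0 := by
  rw [dM_Rm hΓ, dM_Rm hΓ, dM_Rm hΓ, dM_comm (hΓ j) m i, dM_comm (hΓ i) m j, dM_comm (hΓ m) i j]
  unfold Rm
  noncomm_ring

theorem Rm_antisymm (i j : Fin d) (x : Fin d → ℝ) : Rm Γ i j x = - Rm Γ j i x := by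
  unfold Rm; abel

theorem RmH_antisymm (hΓ : ∀ i, SmM (Γ i)) (hH : SmM H)
    (hdH : ∀ i x, dM i H x = - (Γ i x * H x) - H x * (Γ i x).transpose)
    (i j : Fin d) (x : Fin d → ℝ) :
    Rm Γ i j x * H x = - (H x * (Rm Γ i j x).transpose) := by
  have key : ∀ a b, dM a (dM b H) x = - (dM a (Γ b) x * H x + Γ b x * dM a H x)
      - (dM a H x * (Γ b x).transpose + H x * (dM a (Γ b) x).transpose) := by
    intro a b
    have : dM b H = fun y => - (Γ b y * H y) - H y * (Γ b y).transpose := funext (hdH b)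
    rw [this, dM_sub ((hΓ b).mul hH).neg (hH.mul (hΓ b).transpose), dM_neg,
      dM_mul (hΓ b) hH, dM_mul hH (hΓ b).transpose, dM_transpose]
  have h := dM_comm hH i j x
  rw [key, key, hdH, hdH] at h
  rw [← sub_eq_zero] at h ⊢
  rw [← neg_eq_zero, ← h]
  unfold Rm
  simp only [Matrix.transpose_add, Matrix.transpose_sub, Matrix.transpose_mul]
  noncomm_ring

theorem KH_bianchi (hΓ : ∀ i, SmM (Γ i)) (hH : SmM H)
    (hdH : ∀ i x, dM i H x = - (Γ i x * H x) - H x * (Γ i x).transpose)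
    (m i j : Fin d) (x : Fin d → ℝ) (K : Fin d → Fin d → (Fin d → ℝ) → Matrix (Fin d) (Fin d) ℝ)
    (hK : ∀ i j y, K i j y = Rm Γ i j y * H y) :
    (dM m (K i j) x + Γ m x * K i j x + K i j x * (Γ m x).transpose)
    + (dM i (K j m) x + Γ i x * K j m x + K j m x * (Γ i x).transpose)
    + (dM j (K m i) x + Γ j x * K m i x + K m i x * (Γ j x).transpose) = 0 := by
  have key : ∀ a b c, dM a (K b c) x + Γ a x * K b c x + K b c x * (Γ a x).transpose
      = (dM a (Rm Γ b c) x + Γ a x * Rm Γ b c x - Rm Γ b c x * Γ a x) * H x := by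
    intro a b c
    have : K b c = fun y => Rm Γ b c y * H y := funext (hK b c)
    rw [this, dM_mul (Rm_smooth hΓ b c) hH, hdH]
    noncomm_ring
  rw [key, key, key, ← add_mul, ← add_mul, Rm_bianchi hΓ, zero_mul]

/-- contracted Bianchi identity -/
theorem contracted (hΓ : ∀ i, SmM (Γ i)) (hH : SmM H)
    (hsym : ∀ x, (H x).transpose = H x)
    (htor : ∀ i j k x, Γ i x k j = Γ j x k i)
    (hdH : ∀ i x, dM i H x = - (Γ i x * H x) - H x * (Γ i x).transpose)
    (ρ : Fin d → Fin d → (Fin d → ℝ) → ℝ)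
    (hρ : ∀ i m x, ρ i m x = ∑ j, (Rm Γ j m x * H x) j i)
    (m : Fin d) (x : Fin d → ℝ) :
    pd m (fun y => ∑ i, ρ i i y) x = 2 * ∑ i, (pd i (ρ i m) x
      + ∑ p, Γ i x i p * ρ p m x - ∑ p, Γ m x i p * ρ p i x) := by
  obtain ⟨K, hK⟩ : ∃ K : Fin d → Fin d → (Fin d → ℝ) → Matrix (Fin d) (Fin d) ℝ,
    ∀ i j y, K i j y = Rm Γ i j y * H y := ⟨fun i j y => Rm Γ i j y * H y, fun _ _ _ => rfl⟩
  have hKs : ∀ i j, SmM (K i j) := by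
    intro i j
    rw [show K i j = fun y => Rm Γ i j y * H y from funext (hK i j)]
    exact (Rm_smooth hΓ i j).mul hH
  have a1 : ∀ i j y a b, K i j y a b = - K j i y a b := by
    intro i j y a b
    rw [hK, hK, Rm_antisymm, neg_mul]; rfl
  have a2 : ∀ i j y a b, K i j y a b = - K i j y b a := by
    intro i j y a b
    have h : K i j y = - (K i j y).transpose := by
      rw [hK, Matrix.transpose_mul, hsym]
      exact RmH_antisymm hΓ hH hdH i j y
    exact congrFun (congrFun h a) b
  have a3 : ∀ i j y a b, K i j y a b = K j i y b a := by
    intro i j y a b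
    rw [a1, a2, neg_neg]
  have hρ' : ∀ i m, ρ i m = fun y => ∑ j, K j m y j i := by
    intro i m; funext y; rw [hρ]; simp only [hK]
  have dρ : ∀ k i m, pd k (ρ i m) x = ∑ j, pd k (fun y => K j m y j i) x := by
    intro k i m
    rw [hρ', pd_sum' fun j => hKs j m j i]
  have hρs : ∀ i m, Sm (ρ i m) := by
    intro i m
    rw [hρ']; exact Sm.sum fun j => hKs j m j i
  have hB : ∑ i, ∑ j, ((pd m (fun y => K i j y i j) x + ∑ p, Γ m x i p * K i j x p j
      + ∑ p, K i j x i p * Γ m x j p)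
      + (pd i (fun y => K j m y i j) x + ∑ p, Γ i x i p * K j m x p j
      + ∑ p, K j m x i p * Γ i x j p)
      + (pd j (fun y => K m i y i j) x + ∑ p, Γ j x i p * K m i x p j
      + ∑ p, K m i x i p * Γ j x j p)) = 0 := by
    refine Finset.sum_eq_zero fun i _ => Finset.sum_eq_zero fun j _ => ?_
    have := congrFun (congrFun (KH_bianchi hΓ hH hdH m i j x K hK) i) j
    simp only [Matrix.add_apply, Matrix.mul_apply, Matrix.transpose_apply, Matrix.zero_apply] at this
    exact this
  simp only [Finset.sum_add_distrib] at hB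
  have t1 : ∑ i, ∑ j, pd m (fun y => K i j y i j) x = pd m (fun y => ∑ i, ρ i i y) x := by
    rw [pd_sum' fun i => hρs i i, Finset.sum_comm]
    simp only [dρ]
  have t2 : ∑ i, ∑ j, ∑ p, Γ m x i p * K i j x p j = ∑ i, ∑ p, Γ m x i p * ρ p i x := by
    refine Finset.sum_congr rfl fun i _ => ?_
    rw [Finset.sum_comm]
    refine Finset.sum_congr rfl fun p _ => ?_
    rw [hρ', Finset.mul_sum]
    exact Finset.sum_congr rfl fun j _ => by rw [a3]
  have t3 : ∑ i, ∑ j, ∑ p, K i j x i p * Γ m x j p = ∑ i, ∑ p, Γ m x i p * ρ p i x := by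
    rw [Finset.sum_comm]
    refine Finset.sum_congr rfl fun i _ => ?_
    rw [Finset.sum_comm]
    refine Finset.sum_congr rfl fun p _ => ?_
    rw [hρ', Finset.mul_sum]
    exact Finset.sum_congr rfl fun j _ => by rw [mul_comm]
  have t4 : ∑ i, ∑ j, pd i (fun y => K j m y i j) x = - ∑ i, pd i (ρ i m) x := by
    rw [← Finset.sum_neg_distrib]
    refine Finset.sum_congr rfl fun i _ => ?_
    rw [dρ, ← Finset.sum_neg_distrib]
    refine Finset.sum_congr rfl fun j _ => ?_
    rw [← pd_neg']
    congr 1; funext y; exact a2 _ _ _ _ _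
  have t5 : ∑ i, ∑ j, ∑ p, Γ i x i p * K j m x p j = - ∑ i, ∑ p, Γ i x i p * ρ p m x := by
    rw [← Finset.sum_neg_distrib]
    refine Finset.sum_congr rfl fun i _ => ?_
    rw [Finset.sum_comm, ← Finset.sum_neg_distrib]
    refine Finset.sum_congr rfl fun p _ => ?_
    rw [hρ', Finset.mul_sum, ← Finset.sum_neg_distrib]
    exact Finset.sum_congr rfl fun j _ => by rw [a2]; ring
  have t6 : ∑ i, ∑ j, ∑ p, K j m x i p * Γ i x j p = 0 := by
    rw [Finset.sum_comm]
    refine Finset.sum_eq_zero fun j _ => ?_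
    have h : ∑ i, ∑ p, K j m x i p * Γ i x j p = - ∑ i, ∑ p, K j m x i p * Γ i x j p := by
      conv_lhs => rw [Finset.sum_comm]
      rw [← Finset.sum_neg_distrib]
      refine Finset.sum_congr rfl fun i _ => ?_
      rw [← Finset.sum_neg_distrib]
      refine Finset.sum_congr rfl fun p _ => ?_
      rw [a2, htor p i]; ring
    linarith
  have t7 : ∑ i, ∑ j, pd j (fun y => K m i y i j) x = - ∑ i, pd i (ρ i m) x := by
    rw [← t4, Finset.sum_comm]
    refine Finset.sum_congr rfl fun i _ => Finset.sum_congr rfl fun j _ => ?_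
    congr 1; funext y; exact a3 _ _ _ _ _
  have t8 : ∑ i, ∑ j, ∑ p, Γ j x i p * K m i x p j = 0 := by
    rw [← t6, Finset.sum_comm]
    refine Finset.sum_congr rfl fun i _ => Finset.sum_congr rfl fun j _ =>
      Finset.sum_congr rfl fun p _ => ?_
    rw [a3]; ring
  have t9 : ∑ i, ∑ j, ∑ p, K m i x i p * Γ j x j p = - ∑ i, ∑ p, Γ i x i p * ρ p m x := by
    rw [← t5, Finset.sum_comm]
    refine Finset.sum_congr rfl fun i _ => Finset.sum_congr rfl fun j _ =>
      Finset.sum_congr rfl fun p _ => ?_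
    rw [a3]; ring
  rw [t1, t2, t3, t4, t5, t6, t7, t8, t9] at hB
  simp only [Finset.sum_add_distrib, Finset.sum_sub_distrib]
  linarith

/-- Commutation of covariant derivatives on a vector field, traced. -/
theorem ricci_id (hΓ : ∀ i, SmM (Γ i))
    (v : Fin d → (Fin d → ℝ) → ℝ) (hv : ∀ i, Sm (v i))
    (N : Fin d → Fin d → (Fin d → ℝ) → ℝ)
    (hN : ∀ i m x, N i m x = pd m (v i) x + ∑ p, Γ m x i p * v p x)
    (m : Fin d) (x : Fin d → ℝ) :
    ∑ i, (pd i (N i m) x + ∑ p, Γ i x i p * N p m x - ∑ p, Γ m x i p * N p i x)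
      = pd m (fun y => ∑ i, N i i y) x + ∑ p, (∑ i, Rm Γ i m x i p) * v p x := by
  have hNs : ∀ i m, Sm (N i m) := by
    intro i m
    rw [show N i m = fun x => pd m (v i) x + ∑ p, Γ m x i p * v p x from funext (hN i m)]
    exact ((hv i).pd m).add (Sm.sum fun p => (hΓ m i p).mul (hv p))
  have dN : ∀ k i m, pd k (N i m) x = pd k (pd m (v i)) x
      + ∑ p, (dM k (Γ m) x i p * v p x + Γ m x i p * pd k (v p) x) := by
    intro k i m
    rw [show N i m = fun x => pd m (v i) x + ∑ p, Γ m x i p * v p x from funext (hN i m),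
      pd_add' ((hv i).pd m) (Sm.sum fun p => (hΓ m i p).mul (hv p)),
      pd_sum' fun p => (hΓ m i p).mul (hv p)]
    congr 1
    exact Finset.sum_congr rfl fun p _ => pd_mul' (hΓ m i p) (hv p) k x
  rw [pd_sum' fun i => hNs i i]
  have e : ∑ p, (∑ i, Rm Γ i m x i p) * v p x = ∑ i, ∑ p, Rm Γ i m x i p * v p x := by
    rw [Finset.sum_comm]; simp only [Finset.sum_mul]
  rw [e, ← Finset.sum_add_distrib]
  refine Finset.sum_congr rfl fun i _ => ?_
  have mm : ∀ a b : Fin d, ∑ p, (Γ a x * Γ b x) i p * v p x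
      = ∑ p, Γ a x i p * ∑ q, Γ b x p q * v q x := by
    intro a b
    simp only [Matrix.mul_apply, Finset.sum_mul, Finset.mul_sum]
    rw [Finset.sum_comm]
    simp only [mul_assoc]
  have e2 : ∑ p, Rm Γ i m x i p * v p x = ∑ p, dM i (Γ m) x i p * v p x
      - ∑ p, dM m (Γ i) x i p * v p x + ∑ p, Γ i x i p * ∑ q, Γ m x p q * v q x
      - ∑ p, Γ m x i p * ∑ q, Γ i x p q * v q x := by
    rw [← mm, ← mm, ← Finset.sum_sub_distrib, ← Finset.sum_add_distrib, ← Finset.sum_sub_distrib]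
    refine Finset.sum_congr rfl fun p _ => ?_
    simp only [Rm, Matrix.sub_apply, Matrix.add_apply]; ring
  rw [e2, dN, dN, pd_comm' (hv i) i m]
  simp only [hN, mul_add, Finset.sum_add_distrib]
  ring
end curv


section metric
variable {d : ℕ} {g : (Fin d → ℝ) → Fin d → Fin d → ℝ}

theorem Sm_det {F : (Fin d → ℝ) → Matrix (Fin d) (Fin d) ℝ} (hF : SmM F) :
    Sm (fun y => (F y).det) := by
  simp only [Matrix.det_apply']
  exact Sm.sum fun σ => (Sm.const _).mul (Sm.prod fun i => hF _ _)

theorem SmM_inv {F : (Fin d → ℝ) → Matrix (Fin d) (Fin d) ℝ} (hF : SmM F)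
    (hdet : ∀ x, IsUnit (F x).det) : SmM (fun y => (F y)⁻¹) := by
  intro a b
  have h1 : Sm (fun y => ((F y).det)⁻¹) := ContDiff.inv (Sm_det hF) fun x => (hdet x).ne_zero
  have h2 : Sm (fun y => (F y).adjugate a b) := by
    simp only [Matrix.adjugate_apply]
    refine Sm_det fun k l => ?_
    by_cases hk : k = b
    · subst hk
      simp only [Matrix.updateRow_self]
      exact Sm.const _
    · simp only [Matrix.updateRow_ne hk]
      exact hF k l
  have : (fun y => (F y)⁻¹ a b) = fun y => ((F y).det)⁻¹ * (F y).adjugate a b := by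
    funext y
    rw [Matrix.inv_def, Ring.inverse_eq_inv']; rfl
  rw [this]
  exact h1.mul h2

/-- Christoffel matrices -/
def Gam (g : (Fin d → ℝ) → Fin d → Fin d → ℝ) (i : Fin d) (y : Fin d → ℝ) :
    Matrix (Fin d) (Fin d) ℝ := Matrix.of fun k j => christoffel g y k i j

theorem Gam_tor (hsymm : ∀ x i j, g x i j = g x j i) (i j k : Fin d) (x : Fin d → ℝ) :
    Gam g i x k j = Gam g j x k i := by
  simp only [Gam, Matrix.of_apply, christoffel]
  congr 1
  refine Finset.sum_congr rfl fun l _ => ?_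
  rw [show (fun y => g y j i) = fun y => g y i j from funext fun y => hsymm y j i]
  ring

theorem Sm_g (hg : ContDiff ℝ (⊤ : ℕ∞) g) : SmM (fun y => Matrix.of (g y)) := by
  intro a b
  exact contDiff_pi.1 (contDiff_pi.1 hg a) b

theorem Sm_minv (hg : ContDiff ℝ (⊤ : ℕ∞) g) (hdet : ∀ x, IsUnit (Matrix.of (g x)).det) :
    SmM (minv g) := SmM_inv (Sm_g hg) hdet

theorem Sm_Gam (hg : ContDiff ℝ (⊤ : ℕ∞) g) (hdet : ∀ x, IsUnit (Matrix.of (g x)).det)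
    (i : Fin d) : SmM (Gam g i) := by
  intro a b
  have h : ∀ a b, Sm (fun y => g y a b) := Sm_g hg
  exact (Sm.const _).mul (Sm.sum fun l => (Sm_minv hg hdet a l).mul
    ((((h l b).pd i).add ((h l i).pd b)).sub ((h i b).pd l)))

theorem minv_symm (hsymm : ∀ x i j, g x i j = g x j i) (x : Fin d → ℝ) :
    (minv g x).transpose = minv g x := by
  unfold minv
  rw [Matrix.transpose_nonsing_inv]
  congr 1
  ext a b; exact hsymm x b a

theorem g_Gam (hdet : ∀ x, IsUnit (Matrix.of (g x)).det) (i a b : Fin d) (x : Fin d → ℝ) :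
    (Matrix.of (g x) * Gam g i x) a b = (1 / 2) *
      (pd i (fun y => g y a b) x + pd b (fun y => g y a i) x - pd a (fun y => g y i b) x) := by
  have h : Gam g i x = (1 / 2 : ℝ) • (minv g x * Matrix.of fun l j =>
      (pd i (fun y => g y l j) x + pd j (fun y => g y l i) x - pd l (fun y => g y i j) x)) := by
    ext k j
    simp [Gam, christoffel, Matrix.mul_apply]
  rw [h, Matrix.mul_smul, ← Matrix.mul_assoc, minv, Matrix.mul_nonsing_inv _ (hdet x),
    Matrix.one_mul]
  rfl

theorem dM_g (hsymm : ∀ x i j, g x i j = g x j i)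
    (hdet : ∀ x, IsUnit (Matrix.of (g x)).det) (i : Fin d) (x : Fin d → ℝ) :
    dM i (fun y => Matrix.of (g y)) x = (Gam g i x).transpose * Matrix.of (g x)
      + Matrix.of (g x) * Gam g i x := by
  have ht : (Matrix.of (g x)).transpose = Matrix.of (g x) := by
    ext a b; exact hsymm x b a
  have h : (Gam g i x).transpose * Matrix.of (g x)
      = (Matrix.of (g x) * Gam g i x).transpose := by
    rw [Matrix.transpose_mul, ht]
  rw [h]
  ext a b
  rw [Matrix.add_apply, Matrix.transpose_apply, g_Gam hdet, g_Gam hdet]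
  have hs : ∀ a b, (fun y => g y a b) = fun y => g y b a := fun a b => funext fun y => hsymm y a b
  rw [hs b a, hs b i, hs a i]
  simp only [dM, Matrix.of_apply]
  ring

theorem dM_minv (hg : ContDiff ℝ (⊤ : ℕ∞) g) (hsymm : ∀ x i j, g x i j = g x j i)
    (hdet : ∀ x, IsUnit (Matrix.of (g x)).det) (i : Fin d) (x : Fin d → ℝ) :
    dM i (minv g) x = - (Gam g i x * minv g x) - minv g x * (Gam g i x).transpose := by
  have h1 : ∀ y, minv g y * Matrix.of (g y) = 1 := fun y => Matrix.nonsing_inv_mul _ (hdet y)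
  have h2 : ∀ y, Matrix.of (g y) * minv g y = 1 := fun y => Matrix.mul_nonsing_inv _ (hdet y)
  have h3 := dM_mul (Sm_minv hg hdet) (Sm_g hg) i x
  have h4 : dM i (fun y => minv g y * Matrix.of (g y)) x = 0 := by
    simp only [h1]
    ext a b; exact pd_const' _ _ _
  rw [h4, dM_g hsymm hdet] at h3
  have h5 : dM i (minv g) x = dM i (minv g) x * Matrix.of (g x) * minv g x := by
    rw [Matrix.mul_assoc, h2, Matrix.mul_one]
  rw [h5, eq_neg_of_add_eq_zero_left h3.symm]
  calc _ = - (minv g x * (Gam g i x).transpose * (Matrix.of (g x) * minv g x)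
        + (minv g x * Matrix.of (g x)) * Gam g i x * minv g x) := by noncomm_ring
    _ = _ := by rw [h1, h2]; noncomm_ring

theorem ricci_eq (m k : Fin d) (x : Fin d → ℝ) :
    ricciT g x m k = ∑ j, Rm (Gam g) j m x j k := by
  unfold ricciT
  rw [← Finset.sum_add_distrib]
  refine Finset.sum_congr rfl fun j _ => ?_
  rw [Finset.sum_sub_distrib]
  simp only [Rm, Matrix.sub_apply, Matrix.add_apply, Matrix.mul_apply, dM, Gam, Matrix.of_apply]
  ring
end metric

theorem const_of_pd {d : ℕ} {f : (Fin d → ℝ) → ℝ} (hf : Sm f) (h : ∀ m x, pd m f x = 0)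
    (x y : Fin d → ℝ) : f x = f y := by
  refine is_const_of_fderiv_eq_zero hf.diff (fun z => ?_) x y
  apply ContinuousLinearMap.coe_injective
  refine (Pi.basisFun ℝ (Fin d)).ext fun m => ?_
  simpa [pd] using h m z

/-- on a (connected) quasi-Einstein manifold `(M,g,Ω)` of dimension `d ≥ 3`,
i.e. `Hess_g Ω + Ω Sch_g - 𝔰 g = 0` with `𝔰 = d⁻¹(□_gΩ + Ω L)`, the quantity
`λ = 2𝔰Ω - |∇Ω|²_g` is constant. -/
theorem lambda_is_constant {d : ℕ} (hd : 3 ≤ d)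
    (g : (Fin d → ℝ) → Fin d → Fin d → ℝ) (Ω : (Fin d → ℝ) → ℝ)
    (hg : ContDiff ℝ (⊤ : ℕ∞) g) (hsymm : ∀ x i j, g x i j = g x j i)
    (hdet : ∀ x, IsUnit (Matrix.of (g x)).det)
    (hΩ : ContDiff ℝ (⊤ : ℕ∞) Ω)
    (hQE : ∀ x i j, hessT g Ω x i j + Ω x * schoutenT g x i j - sQE g Ω x * g x i j = 0) :
    ∀ x y, 2 * sQE g Ω x * Ω x - normSqGradT g Ω x
      = 2 * sQE g Ω y * Ω y - normSqGradT g Ω y := by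
  obtain ⟨H, hHdef⟩ : ∃ H, H = minv g := ⟨_, rfl⟩
  obtain ⟨Γ, hΓdef⟩ : ∃ Γ, Γ = Gam g := ⟨_, rfl⟩
  have hH : SmM H := hHdef ▸ Sm_minv hg hdet
  have hΓ : ∀ i, SmM (Γ i) := hΓdef ▸ Sm_Gam hg hdet
  have hHs : ∀ x, (H x).transpose = H x := hHdef ▸ minv_symm hsymm
  have hHs' : ∀ x a b, H x a b = H x b a := fun x a b => congrFun (congrFun (hHs x) b) a
  have htor : ∀ i j k x, Γ i x k j = Γ j x k i := hΓdef ▸ Gam_tor hsymm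
  have hdH : ∀ i x, dM i H x = - (Γ i x * H x) - H x * (Γ i x).transpose := by
    subst hHdef hΓdef; exact dM_minv hg hsymm hdet
  have hHg : ∀ x i m, ∑ j, H x i j * g x m j = if i = m then 1 else 0 := by
    intro x i m
    have h := congrFun (congrFun (Matrix.nonsing_inv_mul _ (hdet x)) i) m
    rw [Matrix.mul_apply, Matrix.one_apply] at h
    rw [← h, hHdef]
    exact Finset.sum_congr rfl fun j _ => by rw [hsymm x m j]; rfl
  have hΩs : Sm Ω := hΩ
  -- mixed Ricci tensor
  obtain ⟨ρ, hρ⟩ : ∃ ρ : Fin d → Fin d → (Fin d → ℝ) → ℝ,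
    ∀ i m x, ρ i m x = ∑ j, (Rm Γ j m x * H x) j i := ⟨_, fun _ _ _ => rfl⟩
  have hρs : ∀ i m, Sm (ρ i m) := by
    intro i m
    rw [show ρ i m = fun x => ∑ j, (Rm Γ j m x * H x) j i from funext (hρ i m)]
    exact Sm.sum fun j => (Rm_smooth hΓ j m).mul hH j i
  have hρr : ∀ i m x, ρ i m x = ∑ k, H x i k * ricciT g x m k := by
    intro i m x
    rw [hρ]
    simp only [Matrix.mul_apply]
    rw [Finset.sum_comm]
    refine Finset.sum_congr rfl fun k _ => ?_
    rw [ricci_eq, ← hΓdef, Finset.mul_sum]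
    exact Finset.sum_congr rfl fun j _ => by rw [hHs' x i k, mul_comm]
  have hS : ∀ x, scalT g x = ∑ i, ρ i i x := by
    intro x
    simp only [hρr]
    unfold scalT
    rw [← hHdef, Finset.sum_comm]
  have hSs : Sm (scalT g) := by
    rw [show scalT g = _ from funext hS]
    exact Sm.sum fun i => hρs i i
  have bianchi : ∀ m x, pd m (scalT g) x = 2 * ∑ i, (pd i (ρ i m) x
      + ∑ p, Γ i x i p * ρ p m x - ∑ p, Γ m x i p * ρ p i x) := by
    intro m x
    rw [show scalT g = _ from funext hS]
    exact contracted hΓ hH hHs htor hdH ρ hρ m x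
  -- gradient and mixed Hessian
  obtain ⟨v, hv⟩ : ∃ v : Fin d → (Fin d → ℝ) → ℝ, ∀ i x, v i x = ∑ j, H x i j * pd j Ω x :=
    ⟨_, fun _ _ => rfl⟩
  have hvs : ∀ i, Sm (v i) := by
    intro i
    rw [show v i = _ from funext (hv i)]
    exact Sm.sum fun j => (hH i j).mul (hΩs.pd j)
  obtain ⟨N, hN⟩ : ∃ N : Fin d → Fin d → (Fin d → ℝ) → ℝ,
    ∀ i m x, N i m x = pd m (v i) x + ∑ p, Γ m x i p * v p x := ⟨_, fun _ _ _ => rfl⟩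
  have hNs : ∀ i m, Sm (N i m) := by
    intro i m
    rw [show N i m = fun x => pd m (v i) x + ∑ p, Γ m x i p * v p x from funext (hN i m)]
    exact ((hvs i).pd m).add (Sm.sum fun p => (hΓ m i p).mul (hvs p))
  have hNh : ∀ i m x, N i m x = ∑ j, H x i j * hessT g Ω x m j := by
    intro i m x
    have e1 : pd m (v i) x = ∑ j, (dM m H x i j * pd j Ω x + H x i j * pd m (pd j Ω) x) := by
      rw [show v i = _ from funext (hv i), pd_sum' fun j => (hH i j).mul (hΩs.pd j)]
      exact Finset.sum_congr rfl fun j _ => pd_mul' (hH i j) (hΩs.pd j) m x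
    have e2 : ∑ j, (Γ m x * H x) i j * pd j Ω x = ∑ p, Γ m x i p * v p x := by
      simp only [Matrix.mul_apply, Finset.sum_mul, hv, Finset.mul_sum]
      rw [Finset.sum_comm]; simp only [mul_assoc]
    have e3 : ∑ j, (H x * (Γ m x).transpose) i j * pd j Ω x
        = ∑ j, H x i j * ∑ k, christoffel g x k m j * pd k Ω x := by
      simp only [Matrix.mul_apply, Finset.sum_mul, Finset.mul_sum, Matrix.transpose_apply]
      rw [Finset.sum_comm]
      refine Finset.sum_congr rfl fun a _ => Finset.sum_congr rfl fun b _ => ?_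
      rw [hΓdef, mul_assoc]; rfl
    rw [hN, e1, ← e2]
    simp only [hessT, mul_sub, Finset.sum_sub_distrib, Finset.sum_add_distrib, hdH,
      Matrix.sub_apply, Matrix.neg_apply, sub_mul, neg_mul, Finset.sum_neg_distrib]
    rw [e3]; ring
  have hd' : (3 : ℝ) ≤ d := by exact_mod_cast hd
  obtain ⟨a, ha⟩ : ∃ a : ℝ, a = 1 / ((d : ℝ) - 2) := ⟨_, rfl⟩
  obtain ⟨c, hc⟩ : ∃ c : ℝ, c = 1 / (2 * ((d : ℝ) - 1)) := ⟨_, rfl⟩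
  obtain ⟨s, hs⟩ : ∃ s, s = sQE g Ω := ⟨_, rfl⟩
  -- the mixed equation
  have hE : ∀ i m x, N i m x = (s x + a * c * (Ω x * scalT g x)) * (if i = m then 1 else 0)
      - a * (Ω x * ρ i m x) := by
    intro i m x
    have h0 : ∀ j, H x i j * hessT g Ω x m j = (s x + a * c * (Ω x * scalT g x))
        * (H x i j * g x m j) - a * (Ω x * (H x i j * ricciT g x m j)) := by
      intro j
      have h := hQE x m j
      rw [schoutenT, ← ha, ← hs, div_eq_mul_one_div, ← hc] at h
      linear_combination H x i j * h
    rw [hNh, ← hHg, hρr, Finset.mul_sum, Finset.mul_sum, Finset.mul_sum,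
      ← Finset.sum_sub_distrib]
    exact Finset.sum_congr rfl fun j _ => h0 j
  have htr : ∀ x, ∑ i, N i i x = d * (s x + a * c * (Ω x * scalT g x))
      - a * (Ω x * scalT g x) := by
    intro x
    simp only [hE, if_true, Finset.sum_sub_distrib, hS x, ← Finset.mul_sum]
    simp [mul_comm]
  have hss : Sm s := by
    have h : s = fun x => (1 / (d : ℝ)) * (∑ i, N i i x + (a - d * (a * c)) * (Ω x * scalT g x)) := by
      funext x
      rw [htr]
      field_simp
      ring
    rw [h]
    exact (Sm.const _).mul ((Sm.sum fun i => hNs i i).add ((Sm.const _).mul (hΩs.mul hSs)))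
  have hus : Sm (fun x => Ω x * scalT g x) := hΩs.mul hSs
  have hac : Sm (fun x => s x + a * c * (Ω x * scalT g x)) := hss.add ((Sm.const _).mul hus)
  have dac : ∀ m x, pd m (fun x => s x + a * c * (Ω x * scalT g x)) x = pd m s x
      + a * c * (pd m Ω x * scalT g x + Ω x * pd m (scalT g) x) := by
    intro m x
    rw [pd_add' hss ((Sm.const _).mul hus), pd_mul' (Sm.const _) hus, pd_const',
      pd_mul' hΩs hSs]
    ring
  have dtr : ∀ m x, pd m (fun x => ∑ i, N i i x) x = d * (pd m s x
      + a * c * (pd m Ω x * scalT g x + Ω x * pd m (scalT g) x))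
      - a * (pd m Ω x * scalT g x + Ω x * pd m (scalT g) x) := by
    intro m x
    rw [show (fun x => ∑ i, N i i x) = _ from funext htr,
      pd_sub' ((Sm.const _).mul hac) ((Sm.const _).mul hus), pd_mul' (Sm.const _) hac,
      pd_mul' (Sm.const _) hus, pd_const', pd_const', dac, pd_mul' hΩs hSs]
    ring
  have dE : ∀ k i m x, pd k (N i m) x = (pd k s x
      + a * c * (pd k Ω x * scalT g x + Ω x * pd k (scalT g) x)) * (if i = m then 1 else 0)
      - a * (pd k Ω x * ρ i m x + Ω x * pd k (ρ i m) x) := by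
    intro k i m x
    rw [show N i m = _ from funext (hE i m),
      pd_sub' (hac.mul (Sm.const _)) ((Sm.const _).mul (hΩs.mul (hρs i m))),
      pd_mul' hac (Sm.const _), pd_mul' (Sm.const _) (hΩs.mul (hρs i m)),
      pd_mul' hΩs (hρs i m), pd_const', pd_const', dac]
    ring
  -- divergence of the mixed equation
  have hdiv : ∀ m x, ∑ i, (pd i (N i m) x + ∑ p, Γ i x i p * N p m x - ∑ p, Γ m x i p * N p i x)
      = pd m s x + a * c * (pd m Ω x * scalT g x + Ω x * pd m (scalT g) x)
        - a * (∑ i, pd i Ω x * ρ i m x) - a * (Ω x * (pd m (scalT g) x / 2)) := by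
    intro m x
    have hb : pd m (scalT g) x / 2 = ∑ i, (pd i (ρ i m) x
      + ∑ p, Γ i x i p * ρ p m x - ∑ p, Γ m x i p * ρ p i x) := by
      rw [bianchi]; ring
    rw [hb]
    have e1 : ∀ i, ∑ p, Γ i x i p * N p m x = (s x + a * c * (Ω x * scalT g x)) * Γ i x i m
        - a * (Ω x * ∑ p, Γ i x i p * ρ p m x) := by
      intro i
      rw [Finset.mul_sum, Finset.mul_sum]
      have : Γ i x i m = ∑ p, Γ i x i p * (if p = m then 1 else 0) := by simp
      rw [this, Finset.mul_sum, ← Finset.sum_sub_distrib]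
      exact Finset.sum_congr rfl fun p _ => by rw [hE]; ring
    have e2 : ∀ i, ∑ p, Γ m x i p * N p i x = (s x + a * c * (Ω x * scalT g x)) * Γ i x i m
        - a * (Ω x * ∑ p, Γ m x i p * ρ p i x) := by
      intro i
      rw [Finset.mul_sum, Finset.mul_sum]
      have : Γ i x i m = ∑ p, Γ m x i p * (if p = i then 1 else 0) := by simp [htor i m]
      rw [this, Finset.mul_sum, ← Finset.sum_sub_distrib]
      exact Finset.sum_congr rfl fun p _ => by rw [hE]; ring
    have e3 : pd m s x + a * c * (pd m Ω x * scalT g x + Ω x * pd m (scalT g) x)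
        = ∑ i, (pd i s x + a * c * (pd i Ω x * scalT g x + Ω x * pd i (scalT g) x))
          * (if i = m then 1 else 0) := by simp
    rw [e3, Finset.mul_sum, Finset.mul_sum, Finset.mul_sum, ← Finset.sum_sub_distrib,
      ← Finset.sum_sub_distrib]
    refine Finset.sum_congr rfl fun i _ => ?_
    rw [dE, e1, e2]; ring
  have hric : ∀ m x, ∑ p, (∑ i, Rm Γ i m x i p) * v p x = ∑ i, pd i Ω x * ρ i m x := by
    intro m x
    simp only [hv, hρr, Finset.mul_sum]
    rw [Finset.sum_comm]
    refine Finset.sum_congr rfl fun i _ => Finset.sum_congr rfl fun p _ => ?_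
    rw [ricci_eq, ← hΓdef, hHs' x i p]; ring
  have hkey : ∀ m x, pd m s x + a * (∑ i, pd i Ω x * ρ i m x) - a * c * (pd m Ω x * scalT g x)
      = 0 := by
    intro m x
    have h := ricci_id hΓ v hvs N hN m x
    rw [hdiv, dtr, hric] at h
    have h2 : (d : ℝ) - 2 ≠ 0 := by linarith
    have h1 : (d : ℝ) - 1 ≠ 0 := by linarith
    have ha' : a * ((d : ℝ) - 2) = 1 := by rw [ha]; field_simp
    have hc' : c * (2 * ((d : ℝ) - 1)) = 1 := by rw [hc]; field_simp
    have h3 : ((d : ℝ) - 1) * (pd m s x + a * (∑ i, pd i Ω x * ρ i m x)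
        - a * c * (pd m Ω x * scalT g x)) = 0 := by
      linear_combination -h + (∑ i, pd i Ω x * ρ i m x) * ha' - (a * (pd m Ω x * scalT g x)
        + a * (Ω x * pd m (scalT g) x) / 2) * hc'
    exact (mul_eq_zero.1 h3).resolve_left h1
  -- conclusion
  have hnorm : ∀ x, normSqGradT g Ω x = ∑ i, v i x * pd i Ω x := by
    intro x
    unfold normSqGradT gradT
    simp only [hv, hHdef]
  have hns : Sm (normSqGradT g Ω) := by
    rw [show normSqGradT g Ω = _ from funext hnorm]
    exact Sm.sum fun i => (hvs i).mul (hΩs.pd i)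
  have dnorm : ∀ m x, pd m (normSqGradT g Ω) x = 2 * ∑ i, pd i Ω x * N i m x := by
    intro m x
    rw [show normSqGradT g Ω = _ from funext hnorm, pd_sum' fun i => (hvs i).mul (hΩs.pd i)]
    have e1 : ∑ i, pd i Ω x * N i m x = ∑ i, v i x * hessT g Ω x m i := by
      simp only [hNh, hv, Finset.mul_sum, Finset.sum_mul]
      rw [Finset.sum_comm]
      refine Finset.sum_congr rfl fun i _ => Finset.sum_congr rfl fun p _ => ?_
      rw [hHs' x i p]; ring
    have e2 : ∑ i, v i x * hessT g Ω x m i = ∑ i, v i x * pd m (pd i Ω) x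
        - ∑ i, pd i Ω x * ∑ p, Γ m x i p * v p x := by
      simp only [hessT, mul_sub, Finset.sum_sub_distrib]
      congr 1
      simp only [Finset.mul_sum]
      rw [Finset.sum_comm]
      refine Finset.sum_congr rfl fun i _ => Finset.sum_congr rfl fun p _ => ?_
      rw [hΓdef]
      simp only [Gam, Matrix.of_apply]; ring
    have e3 : ∑ i, pd i Ω x * N i m x = ∑ i, pd i Ω x * pd m (v i) x
        + ∑ i, pd i Ω x * ∑ p, Γ m x i p * v p x := by
      simp only [hN, mul_add, Finset.sum_add_distrib]
    have e4 : ∑ i, pd m (fun y => v i y * pd i Ω y) x = ∑ i, pd i Ω x * pd m (v i) x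
        + ∑ i, v i x * pd m (pd i Ω) x := by
      rw [← Finset.sum_add_distrib]
      exact Finset.sum_congr rfl fun i _ => by rw [pd_mul' (hvs i) (hΩs.pd i)]; ring
    rw [e4]
    linarith
  have hsum : ∀ m x, ∑ i, pd i Ω x * N i m x = (s x + a * c * (Ω x * scalT g x)) * pd m Ω x
      - a * (Ω x * ∑ i, pd i Ω x * ρ i m x) := by
    intro m x
    have : pd m Ω x = ∑ i, pd i Ω x * (if i = m then 1 else 0) := by simp
    rw [this, Finset.mul_sum, Finset.mul_sum, Finset.mul_sum, ← Finset.sum_sub_distrib]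
    exact Finset.sum_congr rfl fun i _ => by rw [hE]; ring
  rw [← hs]
  have h2s : Sm (fun x => 2 * s x) := (Sm.const 2).mul hss
  refine const_of_pd (f := fun x => 2 * s x * Ω x - normSqGradT g Ω x)
    ((h2s.mul hΩs).sub hns) (fun m x => ?_)
  rw [pd_sub' (h2s.mul hΩs) hns, pd_mul' h2s hΩs, pd_mul' (Sm.const 2) hss, pd_const', dnorm, hsum]
  linear_combination 2 * Ω x * hkey m x
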